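/- A finitely generated non-exceptional semigroup S of polynomials is right amenable if and only if S has subexponential growth. -/

import Mathlib

/-- A real-valued function on `σ` is bounded. -/
def Bdd {σ : Type*} (f : σ → ℝ) : Prop := ∃ C : ℝ, ∀ s, |f s| ≤ C

/-- A mean on `σ`: a normalized positive real-linear functional on the space `ℓ∞(σ)`
of bounded real-valued functions on `σ`. -/
structure Mean (σ : Type*) where
  toFun : (σ → ℝ) → ℝ
  map_add' : ∀ f g : σ → ℝ, Bdd f → Bdd g → toFun (f + g) = toFun f + toFun g
  map_smul' : ∀ (c : ℝ) (f : σ → ℝ), Bdd f → toFun (c • f) = c * toFun f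
  nonneg' : ∀ f : σ → ℝ, Bdd f → (∀ s, 0 ≤ f s) → 0 ≤ toFun f
  one' : toFun (fun _ => (1 : ℝ)) = 1

/-- `M` is a left invariant mean on a set `S` of polynomials, regarded as a semigroup
with product `g·h := g ∘ h` (polynomial composition):  `M (g ↦ f (h ∘ g)) = M f`. -/
def PolyLeftInv (S : Set (Polynomial ℂ)) (M : Mean S) : Prop :=
  ∀ (h : S) (hc : ∀ g : S, (h : Polynomial ℂ).comp (g : Polynomial ℂ) ∈ S),
    ∀ f : S → ℝ, Bdd f →
      M.toFun (fun g : S => f ⟨(h : Polynomial ℂ).comp (g : Polynomial ℂ), hc g⟩) = M.toFun f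

/-- `M` is a right invariant mean on a set `S` of polynomials under composition:
`M (g ↦ f (g ∘ h)) = M f`. -/
def PolyRightInv (S : Set (Polynomial ℂ)) (M : Mean S) : Prop :=
  ∀ (h : S) (hc : ∀ g : S, (g : Polynomial ℂ).comp (h : Polynomial ℂ) ∈ S),
    ∀ f : S → ℝ, Bdd f →
      M.toFun (fun g : S => f ⟨(g : Polynomial ℂ).comp (h : Polynomial ℂ), hc g⟩) = M.toFun f

/-- The affine conjugate `σ ∘ P ∘ σ⁻¹` of `P` by `σ(z) = a z + b` (with
`σ⁻¹(z) = a⁻¹ (z - b)`), as a polynomial. -/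
noncomputable def affConj (a b : ℂ) (P : Polynomial ℂ) : Polynomial ℂ :=
  ((Polynomial.C a * Polynomial.X + Polynomial.C b).comp P).comp
    (Polynomial.C a⁻¹ * (Polynomial.X - Polynomial.C b))

/-- A polynomial is exceptional if it has degree at most one, or is affinely conjugate
to the power map `z ↦ z^{deg P}` or to `± T_{deg P}` where `T_n` is the degree-`n`
Chebyshev polynomial. -/
def IsExceptional (P : Polynomial ℂ) : Prop :=
  P.natDegree ≤ 1 ∨
  ∃ a b : ℂ, a ≠ 0 ∧
    (affConj a b P = Polynomial.X ^ P.natDegree ∨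
     affConj a b P = Polynomial.Chebyshev.T ℂ (P.natDegree : ℤ) ∨
     affConj a b P = -Polynomial.Chebyshev.T ℂ (P.natDegree : ℤ))

/-- The set of polynomials expressible as a composition of at most `n` elements
of the finite set `F` (nonempty words of length at most `n`). -/
def wordsUpTo (F : Finset (Polynomial ℂ)) (n : ℕ) : Set (Polynomial ℂ) :=
  {p | ∃ l : List (Polynomial ℂ), l ≠ [] ∧ l.length ≤ n ∧ (∀ q ∈ l, q ∈ F) ∧
        p = l.foldr Polynomial.comp Polynomial.X}

/-- The growth function of the semigroup generated by `F`: the number of elements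
expressible as a product of at most `n` elements of `F`. -/
noncomputable def growth (F : Finset (Polynomial ℂ)) (n : ℕ) : ℕ := (wordsUpTo F n).ncard

open Polynomial
theorem coeff_geom {A B : ℂ[X]} {m : ℕ} (hA : A.natDegree ≤ m) (hB : B.natDegree ≤ m)
    (hl : A.coeff m = B.coeff m) (n : ℕ) :
    (∑ j ∈ Finset.range (n+1), B ^ j * A ^ (n - j)).coeff (n * m) = (n + 1) * A.coeff m ^ n := by
  rw [finsetSum_coeff]
  have : ∀ j ∈ Finset.range (n+1), (B ^ j * A ^ (n - j)).coeff (n * m) = A.coeff m ^ n := by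
    intro j hj
    have hj : j ≤ n := by simpa [Nat.lt_succ_iff] using hj
    have h1 : n * m = j * m + (n - j) * m := by rw [← add_mul]; congr 1; omega
    rw [h1, coeff_mul_add_eq_of_natDegree_le (natDegree_pow_le_of_le j hB) (natDegree_pow_le_of_le _ hA),
      coeff_pow_of_natDegree_le hB, coeff_pow_of_natDegree_le hA, ← hl, ← pow_add]
    congr 1; omega
  rw [Finset.sum_congr rfl this]; simp

theorem natDegree_geom_le {A B : ℂ[X]} {m : ℕ} (hA : A.natDegree ≤ m) (hB : B.natDegree ≤ m)
    (n : ℕ) : (∑ j ∈ Finset.range (n+1), B ^ j * A ^ (n - j)).natDegree ≤ n * m := by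
  refine natDegree_sum_le_of_forall_le _ _ fun j hj => ?_
  have hj : j ≤ n := by simpa [Nat.lt_succ_iff] using hj
  have h1 : n * m = j * m + (n - j) * m := by rw [← add_mul]; congr 1; omega
  rw [h1]
  exact natDegree_mul_le_of_le (natDegree_pow_le_of_le j hB) (natDegree_pow_le_of_le _ hA)

/-- The divided difference of `v` at two polynomials with the same leading term. -/
theorem exists_comp_sub_comp_eq {A B : ℂ[X]} {m : ℕ} (hA : A.natDegree = m) (hB : B.natDegree = m)
    (hm : 0 < m) (hl : A.leadingCoeff = B.leadingCoeff) (v : ℂ[X]) {n : ℕ}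
    (hv : v.natDegree = n + 1) :
    ∃ g : ℂ[X], v.comp B - v.comp A = (B - A) * g ∧ g.natDegree = n * m ∧ g ≠ 0 := by
  have hl' : A.coeff m = B.coeff m := by
    simpa [leadingCoeff, hA, hB] using hl
  have hA0 : A ≠ 0 := by rintro rfl; simp at hA; omega
  suffices h : ∃ g : ℂ[X], v.comp B - v.comp A = (B - A) * g ∧ g.natDegree ≤ n * m ∧
      g.coeff (n * m) ≠ 0 by
    obtain ⟨g, h1, h2, h3⟩ := h
    exact ⟨g, h1, natDegree_eq_of_le_of_coeff_ne_zero h2 h3, by rintro rfl; simp at h3⟩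
  refine ⟨∑ i ∈ Finset.range (n + 1), C (v.coeff (i + 1)) *
    ∑ j ∈ Finset.range (i + 1), B ^ j * A ^ (i - j), ?_, ?_, ?_⟩
  · have hsum : ∀ p : ℂ[X], v.comp p =
        ∑ i ∈ Finset.range (n + 1), C (v.coeff (i + 1)) * p ^ (i + 1) + C (v.coeff 0) := by
      intro p
      rw [comp, eval₂_eq_sum_range, hv, Finset.sum_range_succ', pow_zero, mul_one]
    rw [hsum, hsum, add_sub_add_right_eq_sub, ← Finset.sum_sub_distrib, Finset.mul_sum]
    refine Finset.sum_congr rfl fun i _ => ?_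
    have h3 : (B - A) * ∑ j ∈ Finset.range (i + 1), B ^ j * A ^ (i - j)
        = B ^ (i + 1) - A ^ (i + 1) := (Commute.all B A).mul_geom_sum₂ (i + 1)
    rw [mul_left_comm, h3, mul_sub]
  · refine natDegree_sum_le_of_forall_le _ _ fun i hi => ?_
    have hi : i ≤ n := by simpa [Nat.lt_succ_iff] using hi
    refine (natDegree_C_mul_le _ _).trans ((natDegree_geom_le hA.le hB.le i).trans ?_)
    gcongr
  · rw [Finset.sum_range_succ, coeff_add, coeff_C_mul, coeff_geom hA.le hB.le hl',
      finsetSum_coeff, Finset.sum_eq_zero, ← hv, zero_add]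
    · refine mul_ne_zero (leadingCoeff_ne_zero.2 (by rintro rfl; simp at hv))
        (mul_ne_zero (by exact_mod_cast n.succ_ne_zero) (pow_ne_zero _ ?_))
      rw [← hA]; exact leadingCoeff_ne_zero.2 hA0
    · intro i hi
      refine coeff_eq_zero_of_natDegree_lt (((natDegree_C_mul_le _ _).trans
        (natDegree_geom_le hA.le hB.le i)).trans_lt ?_)
      exact Nat.mul_lt_mul_of_pos_right (Finset.mem_range.1 hi) hm

theorem affine_of_comp_eq_comp {u v A B : ℂ[X]} (hu : 0 < u.natDegree) (hA : 0 < A.natDegree)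
    (hAB : A.natDegree = B.natDegree) (h : u.comp A = v.comp B) :
    ∃ t b : ℂ, t ≠ 0 ∧ B = C t * A + C b := by
  have hA0 : A ≠ 0 := by rintro rfl; simp at hA
  have hB0 : B ≠ 0 := by rintro rfl; simp at hAB; omega
  have ht : B.leadingCoeff / A.leadingCoeff ≠ 0 :=
    div_ne_zero (leadingCoeff_ne_zero.2 hB0) (leadingCoeff_ne_zero.2 hA0)
  set t := B.leadingCoeff / A.leadingCoeff with ht_def
  have hdeg : (C t * A).natDegree = A.natDegree := natDegree_C_mul ht
  have hl : (C t * A).leadingCoeff = B.leadingCoeff := by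
    rw [leadingCoeff_mul, leadingCoeff_C, ht_def,
      div_mul_cancel₀ _ (leadingCoeff_ne_zero.2 hA0)]
  have huv : v.natDegree = u.natDegree := by
    have := congrArg natDegree h
    rw [natDegree_comp, natDegree_comp, ← hAB] at this
    exact (Nat.eq_of_mul_eq_mul_right hA this).symm
  obtain ⟨n, hn⟩ : ∃ n, v.natDegree = n + 1 := ⟨v.natDegree - 1, by omega⟩
  obtain ⟨g, hg, hgd, hg0⟩ := exists_comp_sub_comp_eq hdeg hAB.symm hA hl v hn
  have hu' : (u.comp (C t⁻¹ * X)).comp (C t * A) = u.comp A := by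
    rw [comp_assoc]
    congr 1
    simp [← mul_assoc, ← C_mul, inv_mul_cancel₀ ht]
  have hkey : (u.comp (C t⁻¹ * X) - v).comp (C t * A) = (B - C t * A) * g := by
    rw [sub_comp, hu', h, hg]
  refine ⟨t, (B - C t * A).coeff 0, ht, ?_⟩
  suffices h0 : (B - C t * A).natDegree = 0 by
    rw [← eq_C_of_natDegree_eq_zero h0]; ring
  by_contra h0
  have hne : B - C t * A ≠ 0 := by intro h; simp [h] at h0
  have hlt : (B - C t * A).natDegree < A.natDegree := by
    rw [hAB]
    refine natDegree_lt_natDegree hne (degree_sub_lt_left ?_ hB0 hl.symm)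
    rw [degree_eq_natDegree hB0, degree_eq_natDegree (mul_ne_zero (C_ne_zero.2 ht) hA0), hdeg, hAB]
  have hd := congrArg natDegree hkey
  rw [natDegree_comp, natDegree_mul hne hg0, hgd, hdeg] at hd
  have : A.natDegree ∣ (B - C t * A).natDegree :=
    (Nat.dvd_add_left (Dvd.intro_left n rfl)).1 (hd ▸ Dvd.intro_left _ rfl)
  exact absurd (Nat.le_of_dvd (Nat.pos_of_ne_zero h0) this) (by omega)

theorem comp_right_cancel {p q r : ℂ[X]} (hr : 0 < r.natDegree) (h : p.comp r = q.comp r) :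
    p = q := by
  have h0 : (p - q).comp r = 0 := by rw [sub_comp, h, sub_self]
  rcases comp_eq_zero_iff.1 h0 with h1 | ⟨-, h2⟩
  · exact sub_eq_zero.1 h1
  · rw [h2] at hr; simp at hr

theorem derivative_eval_affine_eq_zero {R : ℂ[X]} {s d t b z : ℂ} (ht : t ≠ 0)
    (h : R.comp (C t * X + C b) = C s * R + C d) (hz : R.derivative.eval z = 0) :
    R.derivative.eval (t * z + b) = 0 := by
  have := congrArg (fun p : ℂ[X] => p.derivative.eval z) h
  simpa [derivative_comp, hz, ht] using this

theorem exists_two_critical_points {P : ℂ[X]} (hP : ¬ IsExceptional P) :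
    ∃ z w : ℂ, z ≠ w ∧ (P.comp P).derivative.eval z = 0 ∧ (P.comp P).derivative.eval w = 0 := by
  simp only [IsExceptional, not_or, not_le] at hP
  obtain ⟨hn, hP⟩ := hP
  by_contra! hne
  obtain ⟨w, hw⟩ : ∃ w, P.derivative.eval w = 0 := by
    refine IsAlgClosed.exists_root P.derivative ?_
    rw [degree_derivative (by omega)]
    exact_mod_cast (by omega : P.natDegree - 1 ≠ 0)
  have hroot : ∀ z, P.eval z = w → z = w := by
    intro z hz
    by_contra hzw
    refine hne z w hzw ?_ ?_ <;> simp [derivative_comp, hz, hw]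
  have hdeg : (P - C w).natDegree = P.natDegree := natDegree_sub_C
  have hQ0 : P - C w ≠ 0 := by intro h; rw [h] at hdeg; simp at hdeg; omega
  have hsplit := IsAlgClosed.splits (P - C w)
  have hroots : (P - C w).roots = Multiset.replicate P.natDegree w := by
    refine Multiset.eq_replicate.2 ⟨?_, fun z hz => hroot z ?_⟩
    · rw [← hdeg]; exact hsplit.natDegree_eq_card_roots.symm
    · have := (mem_roots hQ0).1 hz
      simpa [sub_eq_zero] using this
  have hform := hsplit.eq_prod_roots
  rw [hroots, Multiset.map_replicate, Multiset.prod_replicate] at hform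
  set a := (P - C w).leadingCoeff with ha
  have ha0 : a ≠ 0 := leadingCoeff_ne_zero.2 hQ0
  obtain ⟨α, hα⟩ := IsAlgClosed.exists_pow_nat_eq a (n := P.natDegree - 1) (by omega)
  have hα0 : α ≠ 0 := by
    rintro rfl
    rw [zero_pow (by omega)] at hα
    exact ha0 hα.symm
  refine hP ⟨α, -(α * w), hα0, Or.inl ?_⟩
  have hform' : P = C a * (X - C w) ^ P.natDegree + C w := by rw [← hform]; ring
  obtain ⟨n, hn'⟩ : ∃ n, P.natDegree = n + 1 := ⟨P.natDegree - 1, by omega⟩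
  rw [hn'] at hform' hα ⊢
  have h1 : C α⁻¹ * (X - C (-(α * w))) - C w = (C α⁻¹ * X : ℂ[X]) := by
    have : (C α⁻¹ * C α : ℂ[X]) = 1 := by rw [← C_mul, inv_mul_cancel₀ hα0, C_1]
    simp only [C_neg, C_mul]
    linear_combination C w * this
  have h2 : C α * (C a * (C α⁻¹ * X) ^ (n + 1)) = (X ^ (n + 1) : ℂ[X]) := by
    rw [mul_pow, ← C_pow, ← mul_assoc, ← mul_assoc, ← C_mul, ← C_mul, ← hα]
    have : α * α ^ (n + 1 - 1) * α⁻¹ ^ (n + 1) = 1 := by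
      rw [Nat.add_sub_cancel, ← pow_succ', ← mul_pow, mul_inv_cancel₀ hα0, one_pow]
    rw [this, C_1, one_mul]
  rw [affConj, hform']
  simp only [add_comp, mul_comp, C_comp, X_comp, pow_comp, sub_comp, h1]
  rw [mul_add, h2]
  simp

theorem exists_finset_of_common_left_multiple {S : Set ℂ[X]} {P : ℂ[X]}
    (hcomp : ∀ p ∈ S, ∀ q ∈ S, p.comp q ∈ S) (hdeg : ∀ p ∈ S, 0 < p.natDegree)
    (hrev : ∀ p ∈ S, ∀ q ∈ S, ∃ x ∈ S, ∃ y ∈ S, x.comp p = y.comp q)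
    (hP : P ∈ S) (hexc : ¬ IsExceptional P) :
    ∃ K : ℕ, ∀ m : ℕ, ∃ T : Finset ℂ[X], T.card ≤ K ∧ ∀ Q ∈ S, Q.natDegree = m → Q ∈ T := by
  classical
  obtain ⟨z, w, hzw, hz, hw⟩ := exists_two_critical_points hexc
  have hR : P.comp P ∈ S := hcomp P hP P hP
  generalize P.comp P = R at hz hw hR
  have hR' : R.derivative ≠ 0 := fun h =>
    (hdeg R hR).ne' (derivative_eq_zero.1 h)
  set Z := R.derivative.roots.toFinset
  refine ⟨(Z ×ˢ Z).card, fun m => ?_⟩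
  by_cases hm : ∃ A ∈ S, A.natDegree = m
  swap
  · exact ⟨∅, by simp, fun Q hQ hQm => (hm ⟨Q, hQ, hQm⟩).elim⟩
  obtain ⟨A, hA, hAm⟩ := hm
  refine ⟨(Z ×ˢ Z).image fun x => C ((x.1 - x.2) / (z - w)) * A +
    C (x.1 - (x.1 - x.2) / (z - w) * z), Finset.card_image_le, fun Q hQ hQm => ?_⟩
  obtain ⟨x, hx, y, hy, hxy⟩ := hrev _ (hcomp R hR A hA) _ (hcomp R hR Q hQ)
  rw [← comp_assoc, ← comp_assoc] at hxy
  obtain ⟨t, b, ht, hQA⟩ := affine_of_comp_eq_comp (hdeg _ (hcomp x hx R hR)) (hdeg A hA)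
    (hAm.trans hQm.symm) hxy
  have hQ' : Q = (C t * X + C b).comp A := by simp [hQA]
  rw [hQ'] at hxy
  have hxR := comp_right_cancel (hdeg A hA) (p := x.comp R)
    (q := y.comp (R.comp (C t * X + C b))) (by rw [hxy]; simp only [comp_assoc])
  obtain ⟨s, d, -, hs⟩ := affine_of_comp_eq_comp (hdeg x hx) (hdeg R hR)
    (by rw [natDegree_comp, natDegree_linear ht, mul_one]) hxR
  have hmem : ∀ ζ, R.derivative.eval ζ = 0 → t * ζ + b ∈ Z := fun ζ hζ => by
    simpa [Z, hR'] using derivative_eval_affine_eq_zero ht hs hζ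
  refine Finset.mem_image.2 ⟨(t * z + b, t * w + b),
    Finset.mk_mem_product (hmem z hz) (hmem w hw), ?_⟩
  have h0 : z - w ≠ 0 := sub_ne_zero.2 hzw
  have ht' : (t * z + b - (t * w + b)) / (z - w) = t := by field_simp; ring
  simp only [ht', hQA, add_sub_cancel_left]

theorem natDegree_foldr_comp (l : List ℂ[X]) :
    (l.foldr comp X).natDegree = (l.map natDegree).prod := by
  induction l with
  | nil => simp
  | cons p l ih => simp [natDegree_comp, ih]

theorem foldr_comp_append (l₁ l₂ : List ℂ[X]) :
    (l₁ ++ l₂).foldr comp X = (l₁.foldr comp X).comp (l₂.foldr comp X) := by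
  induction l₁ with
  | nil => simp
  | cons p l ih => simp only [List.cons_append, List.foldr_cons, ih, comp_assoc]

theorem exists_finset_natDegree_words (F : Finset ℂ[X]) (n : ℕ) :
    ∃ D : Finset ℕ, D.card ≤ (n + 1) ^ F.card ∧ ∀ p ∈ wordsUpTo F n, p.natDegree ∈ D := by
  classical
  refine ⟨(Fintype.piFinset fun _ : F => Finset.range (n + 1)).image
    fun k => ∏ q : F, (q : ℂ[X]).natDegree ^ k q, ?_, ?_⟩
  · refine Finset.card_image_le.trans ?_
    simp
  · rintro p ⟨l, -, hl, hF, rfl⟩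
    refine Finset.mem_image.2 ⟨fun q => l.count (q : ℂ[X]), ?_, ?_⟩
    · simp only [Fintype.mem_piFinset, Finset.mem_range]
      exact fun q => Nat.lt_succ_of_le (List.count_le_length.trans hl)
    · rw [natDegree_foldr_comp, Finset.prod_list_map_count,
        Finset.prod_coe_sort F fun q => q.natDegree ^ l.count q]
      refine (Finset.prod_subset (fun q hq => hF q (List.mem_toFinset.1 hq)) fun q _ hq => ?_).symm
      rw [List.count_eq_zero_of_not_mem (fun h => hq (List.mem_toFinset.2 h)), pow_zero]

theorem growth_le_of_natDegree_fibers {F : Finset ℂ[X]} {K : ℕ}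
    (hK : ∀ m : ℕ, ∃ T : Finset ℂ[X], T.card ≤ K ∧
      ∀ n, ∀ Q ∈ wordsUpTo F n, Q.natDegree = m → Q ∈ T) (n : ℕ) :
    growth F n ≤ (n + 1) ^ F.card * K := by
  classical
  choose T hTK hT using hK
  obtain ⟨D, hD, hmem⟩ := exists_finset_natDegree_words F n
  calc growth F n ≤ ((D.biUnion T : Finset ℂ[X]) : Set ℂ[X]).ncard :=
        Set.ncard_le_ncard (fun Q hQ => Finset.mem_coe.2 <|
          Finset.mem_biUnion.2 ⟨_, hmem Q hQ, hT _ n Q hQ rfl⟩) (Finset.finite_toSet _)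
    _ = (D.biUnion T).card := Set.ncard_coe_finset _
    _ ≤ D.card * K := Finset.card_biUnion_le_card_mul _ _ _ fun m _ => hTK m
    _ ≤ _ := Nat.mul_le_mul_right K hD

theorem eventually_le_pow_of_polynomial_bound {a : ℕ → ℕ} {k K : ℕ}
    (ha : ∀ n, a n ≤ (n + 1) ^ k * K) {c : ℝ} (hc : 1 < c) :
    ∃ N : ℕ, ∀ n ≥ N, (a n : ℝ) ≤ c ^ n := by
  have hc0 : 0 < c := by linarith
  have hpos : (0 : ℝ) < 1 / ((K + 1) * c) := by positivity
  have h := ((tendsto_pow_const_div_const_pow_of_one_lt k hc).comp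
    (Filter.tendsto_add_atTop_nat 1)).eventually (gt_mem_nhds hpos)
  obtain ⟨N, hN⟩ := Filter.eventually_atTop.1 h
  refine ⟨N, fun n hn => ?_⟩
  have h1 := hN n hn
  simp only [Function.comp] at h1
  rw [div_lt_div_iff₀ (by positivity) (by positivity), one_mul, pow_succ] at h1
  have h2 : ((n + 1 : ℕ) : ℝ) ^ k * (K + 1) < c ^ n := by
    refine lt_of_mul_lt_mul_right ?_ hc0.le
    linarith
  have h3 : (a n : ℝ) ≤ ((n + 1 : ℕ) : ℝ) ^ k * K := by exact_mod_cast ha n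
  have h4 : (0 : ℝ) ≤ ((n + 1 : ℕ) : ℝ) ^ k := by positivity
  linarith

theorem exists_common_left_multiple_of_rightInv {S : Set ℂ[X]}
    (hcomp : ∀ p ∈ S, ∀ q ∈ S, p.comp q ∈ S) {M : Mean S} (hM : PolyRightInv S M) :
    ∀ p ∈ S, ∀ q ∈ S, ∃ x ∈ S, ∃ y ∈ S, x.comp p = y.comp q := by
  classical
  let χ : ℂ[X] → S → ℝ := fun a s => if ∃ x ∈ S, (s : ℂ[X]) = x.comp a then 1 else 0
  have hχb : ∀ a, Bdd (χ a) := fun a => ⟨1, fun s => by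
    simp only [χ]; split_ifs <;> simp⟩
  have hχ : ∀ a ∈ S, M.toFun (χ a) = 1 := by
    intro a ha
    rw [← hM ⟨a, ha⟩ (fun g => hcomp g g.2 a ha) (χ a) (hχb a), ← M.one']
    congr 1
    funext g
    exact if_pos ⟨g, g.2, rfl⟩
  intro a ha b hb
  by_contra! hne
  have hab : Bdd (χ a + χ b) := by
    obtain ⟨C, hC⟩ := hχb a
    obtain ⟨D, hD⟩ := hχb b
    exact ⟨C + D, fun s => (abs_add_le _ _).trans (add_le_add (hC s) (hD s))⟩
  have hab' : Bdd ((-1 : ℝ) • (χ a + χ b)) := by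
    obtain ⟨C, hC⟩ := hab
    exact ⟨C, fun s => by simpa [abs_neg] using (abs_neg _).trans_le (hC s)⟩
  have h1 : Bdd (fun _ : S => (1 : ℝ)) := ⟨1, fun _ => by simp⟩
  have hle : ∀ s, 0 ≤ ((fun _ : S => (1 : ℝ)) + (-1 : ℝ) • (χ a + χ b)) s := by
    intro s
    simp only [Pi.add_apply, Pi.smul_apply, smul_eq_mul, χ]
    split_ifs with h₁ h₂
    · obtain ⟨x, hx, hxs⟩ := h₁
      obtain ⟨y, hy, hys⟩ := h₂
      exact (hne x hx y hy (hxs.symm.trans hys)).elim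
    all_goals norm_num
  have hb3 : Bdd ((fun _ : S => (1 : ℝ)) + (-1 : ℝ) • (χ a + χ b)) := by
    obtain ⟨C, hC⟩ := hab'
    exact ⟨1 + C, fun s => (abs_add_le _ _).trans (add_le_add (by simp) (hC s))⟩
  have := M.nonneg' _ hb3 hle
  rw [M.map_add' _ _ h1 hab', M.map_smul' _ _ hab, M.map_add' _ _ (hχb a) (hχb b), M.one',
    hχ a ha, hχ b hb] at this
  norm_num at this

open Filter Topology in
theorem exists_mean_of_averages {σ : Type*} (A : ℕ → Finset σ) (hA : ∀ k, (A k).Nonempty) :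
    ∃ M : Mean σ, ∀ f g : σ → ℝ, Bdd f → Bdd g →
      Tendsto (fun k => (∑ a ∈ A k, f a) / (A k).card - (∑ a ∈ A k, g a) / (A k).card)
        atTop (𝓝 0) → M.toFun f = M.toFun g := by
  let avg : (σ → ℝ) → ℕ → ℝ := fun f k => (∑ a ∈ A k, f a) / (A k).card
  let U : Filter ℕ := hyperfilter ℕ
  have hU : U ≤ atTop := Nat.hyperfilter_le_atTop
  have hcard : ∀ k, (0 : ℝ) < (A k).card := fun k => by exact_mod_cast (hA k).card_pos
  have hlim : ∀ f, Bdd f → Tendsto (avg f) U (𝓝 (limUnder U (avg f))) := by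
    rintro f ⟨C, hC⟩
    have hmem : ∀ k, avg f k ∈ Set.Icc (-C) C := fun k => by
      rw [Set.mem_Icc, ← abs_le, abs_div, abs_of_pos (hcard k), div_le_iff₀ (hcard k)]
      calc |∑ a ∈ A k, f a| ≤ ∑ a ∈ A k, |f a| := Finset.abs_sum_le_sum_abs _ _
        _ ≤ (A k).card • C := Finset.sum_le_card_nsmul _ _ _ fun a _ => hC a
        _ = C * (A k).card := by rw [nsmul_eq_mul, mul_comm]
    obtain ⟨x, -, hx⟩ := isCompact_Icc.ultrafilter_le_nhds ((hyperfilter ℕ).map (avg f))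
      (le_principal_iff.2 (mem_map.2 (univ_mem' hmem)))
    exact tendsto_nhds_limUnder ⟨x, hx⟩
  have hunique : ∀ f x, Tendsto (avg f) U (𝓝 x) → limUnder U (avg f) = x := fun f x h =>
    h.limUnder_eq
  refine ⟨⟨fun f => limUnder U (avg f), ?_, ?_, ?_, ?_⟩, ?_⟩
  · intro f g hf hg
    refine hunique _ _ (((hlim f hf).add (hlim g hg)).congr fun k => ?_)
    simp only [avg, Pi.add_apply, Finset.sum_add_distrib, add_div]
  · intro c f hf
    refine hunique _ _ (((hlim f hf).const_mul c).congr fun k => ?_)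
    simp only [avg, Pi.smul_apply, smul_eq_mul, ← Finset.mul_sum, mul_div_assoc]
  · intro f hf h0
    exact ge_of_tendsto' (hlim f hf) fun k =>
      div_nonneg (Finset.sum_nonneg fun a _ => h0 a) (hcard k).le
  · refine hunique _ _ (tendsto_const_nhds.congr fun k => ?_)
    simp [avg, (hcard k).ne']
  · intro f g hf hg h
    exact sub_eq_zero.1 (tendsto_nhds_unique ((hlim f hf).sub (hlim g hg)) (h.mono_left hU))

theorem abs_sum_sub_sum_le_of_subset {σ : Type*} [DecidableEq σ] {A B : Finset σ} (h : A ⊆ B)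
    {f : σ → ℝ} {C : ℝ} (hC : ∀ a, |f a| ≤ C) :
    |∑ a ∈ B, f a - ∑ a ∈ A, f a| ≤ C * (B.card - A.card) := by
  rw [← Finset.sum_sdiff h, add_sub_cancel_right]
  calc |∑ a ∈ B \ A, f a| ≤ ∑ a ∈ B \ A, |f a| := Finset.abs_sum_le_sum_abs _ _
    _ ≤ (B \ A).card • C := Finset.sum_le_card_nsmul _ _ _ fun a _ => hC a
    _ = C * (B.card - A.card) := by
      rw [nsmul_eq_mul, Finset.cast_card_sdiff h, mul_comm]

open Filter Topology in
/-- An increasing sequence of finite sets whose successive cardinality ratios accumulate at `1`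
yields a mean invariant under every injection shifting the sequence by one step. -/
theorem exists_mean_of_slow_growth {σ : Type*} (A : ℕ → Finset σ) (hmono : ∀ n, A n ⊆ A (n + 1))
    (hne : ∀ n, (A n).Nonempty)
    (hslow : ∀ ε : ℝ, 0 < ε → ∃ n, ((A (n + 1)).card : ℝ) ≤ (1 + ε) * (A n).card) :
    ∃ M : Mean σ, ∀ ρ : σ → σ, Function.Injective ρ → (∀ n, ∀ a ∈ A n, ρ a ∈ A (n + 1)) →
      ∀ f, Bdd f → M.toFun (fun s => f (ρ s)) = M.toFun f := by
  classical
  choose n hn using fun k : ℕ => hslow (1 / ((k : ℝ) + 1)) (by positivity)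
  obtain ⟨M, hM⟩ := exists_mean_of_averages (fun k => A (n k)) fun k => hne _
  refine ⟨M, fun ρ hρ hρA f hf => ?_⟩
  obtain ⟨C, hC⟩ := hf
  refine hM _ _ ⟨C, fun s => hC _⟩ ⟨C, hC⟩ ?_
  have hlim : Tendsto (fun k : ℕ => 2 * C * (1 / ((k : ℝ) + 1))) atTop (𝓝 0) := by
    simpa using tendsto_one_div_add_atTop_nhds_zero_nat.const_mul (2 * C)
  refine squeeze_zero_norm (fun k => ?_) hlim
  have hcard : (0 : ℝ) < (A (n k)).card := by exact_mod_cast (hne _).card_pos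
  have hC0 : 0 ≤ C := (abs_nonneg _).trans (hC (hne 0).choose)
  have himg : (A (n k)).image ρ ⊆ A (n k + 1) := Finset.image_subset_iff.2 (hρA _)
  have h1 := abs_sum_sub_sum_le_of_subset himg hC
  have h2 := abs_sum_sub_sum_le_of_subset (hmono (n k)) hC
  rw [Finset.card_image_of_injective _ hρ, Finset.sum_image fun _ _ _ _ h => hρ h] at h1
  have h3 : C * ((A (n k + 1)).card - (A (n k)).card) ≤ C * (1 / ((k : ℝ) + 1) * (A (n k)).card) :=
    mul_le_mul_of_nonneg_left (by linarith [hn k]) hC0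
  rw [Real.norm_eq_abs, ← sub_div, abs_div, abs_of_pos hcard, div_le_iff₀ hcard]
  rw [abs_le] at h1 h2 ⊢
  constructor <;> linarith [h1.1, h1.2, h2.1, h2.2]

open Filter in
theorem exists_succ_le_of_subexponential {a : ℕ → ℕ} (h0 : 0 < a 0)
    (ha : ∀ c : ℝ, 1 < c → ∃ N : ℕ, ∀ n ≥ N, (a n : ℝ) ≤ c ^ (n + 1)) {ε : ℝ} (hε : 0 < ε) :
    ∃ n, (a (n + 1) : ℝ) ≤ (1 + ε) * a n := by
  by_contra! h
  have hlow : ∀ n, (1 + ε) ^ n ≤ (a n : ℝ) := by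
    intro n
    induction n with
    | zero => simpa using (by exact_mod_cast h0 : (1 : ℝ) ≤ a 0)
    | succ n ih =>
      rw [pow_succ']
      exact (mul_le_mul_of_nonneg_left ih (by linarith)).trans (h n).le
  obtain ⟨N, hN⟩ := ha (1 + ε / 2) (by linarith)
  have hc : (0 : ℝ) < 1 + ε / 2 := by linarith
  have hr : 1 < (1 + ε) / (1 + ε / 2) := by rw [one_lt_div hc]; linarith
  obtain ⟨n, hn, hnN⟩ := (((tendsto_pow_atTop_atTop_of_one_lt hr).eventually_gt_atTop
    (1 + ε / 2)).and (eventually_ge_atTop N)).exists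
  rw [div_pow, lt_div_iff₀ (by positivity), ← pow_succ'] at hn
  linarith [hN n hnN, hlow n]

theorem wordsUpTo_finite (F : Finset ℂ[X]) (n : ℕ) : (wordsUpTo F n).Finite := by
  refine ((List.finite_length_le F n).image
    fun l => (l.map Subtype.val).foldr comp X).subset ?_
  rintro p ⟨l, -, hl, hF, rfl⟩
  refine ⟨l.attach.map fun q => ⟨q.1, hF q.1 q.2⟩, by simpa using hl, ?_⟩
  simp [List.map_map, Function.comp_def]

theorem comp_mem_wordsUpTo_succ {F : Finset ℂ[X]} {n : ℕ} {p q : ℂ[X]} (hp : p ∈ wordsUpTo F n)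
    (hq : q ∈ F) : p.comp q ∈ wordsUpTo F (n + 1) := by
  obtain ⟨l, -, hl, hF, rfl⟩ := hp
  refine ⟨l ++ [q], by simp, by simpa using hl, ?_, by rw [foldr_comp_append]; simp⟩
  intro r hr
  rcases List.mem_append.1 hr with hr | hr
  · exact hF r hr
  · rwa [List.mem_singleton.1 hr]

theorem polyRightInv_of_generators {F : Finset ℂ[X]} {S : Set ℂ[X]}
    (hgen : S = {p | ∃ l : List ℂ[X], l ≠ [] ∧ (∀ q ∈ l, q ∈ F) ∧ p = l.foldr comp X})
    {M : Mean S} (hM : ∀ q ∈ F, ∀ hc : ∀ g : S, (g : ℂ[X]).comp q ∈ S, ∀ f : S → ℝ, Bdd f →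
      M.toFun (fun g : S => f ⟨(g : ℂ[X]).comp q, hc g⟩) = M.toFun f) : PolyRightInv S M := by
  have hcomp : ∀ l : List ℂ[X], (∀ q ∈ l, q ∈ F) → ∀ g : S,
      (g : ℂ[X]).comp (l.foldr comp X) ∈ S := by
    rintro l hl ⟨g, hg⟩
    subst hgen
    obtain ⟨l', hl', hF, rfl⟩ := hg
    refine ⟨l' ++ l, by simp [hl'], fun q hq => ?_, (foldr_comp_append _ _).symm⟩
    exact (List.mem_append.1 hq).elim (hF q) (hl q)
  have key : ∀ l : List ℂ[X], (∀ q ∈ l, q ∈ F) →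
      ∀ (hc : ∀ g : S, (g : ℂ[X]).comp (l.foldr comp X) ∈ S) (f : S → ℝ), Bdd f →
      M.toFun (fun g : S => f ⟨(g : ℂ[X]).comp (l.foldr comp X), hc g⟩) = M.toFun f := by
    intro l
    induction l with
    | nil => intro _ hc f _; simp
    | cons q l ih =>
      intro hF hc f hf
      have hFl : ∀ r ∈ l, r ∈ F := fun r hr => hF r (List.mem_cons_of_mem _ hr)
      have hq : q ∈ F := hF q List.mem_cons_self
      have hcq : ∀ g : S, (g : ℂ[X]).comp q ∈ S := by
        simpa using hcomp [q] (by simpa using hq)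
      have hf' : Bdd fun g : S => f ⟨(g : ℂ[X]).comp (l.foldr comp X), hcomp l hFl g⟩ :=
        hf.imp fun C hC s => hC _
      rw [← ih hFl (hcomp l hFl) f hf, ← hM q hq hcq _ hf']
      simp only [List.foldr_cons, comp_assoc]
  rintro ⟨h, hh⟩ hc f hf
  have hh' := hh
  rw [hgen] at hh'
  obtain ⟨l, -, hF, rfl⟩ := hh'
  exact key l hF hc f hf

/-- A finitely generated non-exceptional semigroup of (nonconstant complex)
polynomials is right amenable if and only if it has subexponential growth. -/
theorem right_amenable_iff_subexponential_growth
    (F : Finset (Polynomial ℂ)) (S : Set (Polynomial ℂ))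
    (hgen : S = {p | ∃ l : List (Polynomial ℂ), l ≠ [] ∧ (∀ q ∈ l, q ∈ F) ∧
        p = l.foldr Polynomial.comp Polynomial.X})
    (hdeg : ∀ p ∈ S, 0 < p.natDegree)
    (hexc : ∃ P ∈ S, ¬ IsExceptional P) :
    (∃ M : Mean S, PolyRightInv S M) ↔
      ∀ c : ℝ, 1 < c → ∃ N : ℕ, ∀ n ≥ N, (growth F n : ℝ) ≤ c ^ n := by
  classical
  have hwords : ∀ n, wordsUpTo F n ⊆ S := by
    rintro n p ⟨l, hl, -, hF, rfl⟩
    rw [hgen]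
    exact ⟨l, hl, hF, rfl⟩
  have hcomp : ∀ p ∈ S, ∀ q ∈ S, p.comp q ∈ S := by
    rw [hgen]
    rintro _ ⟨l₁, h₁, hF₁, rfl⟩ _ ⟨l₂, -, hF₂, rfl⟩
    refine ⟨l₁ ++ l₂, by simp [h₁], fun q hq => ?_, (foldr_comp_append _ _).symm⟩
    exact (List.mem_append.1 hq).elim (hF₁ q) (hF₂ q)
  have hFS : ∀ q ∈ F, q ∈ S := fun q hq => by
    rw [hgen]
    exact ⟨[q], by simp, by simpa using hq, by simp⟩
  obtain ⟨P, hP, hPexc⟩ := hexc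
  constructor
  · rintro ⟨M, hM⟩ c hc
    obtain ⟨K, hK⟩ := exists_finset_of_common_left_multiple hcomp hdeg
      (exists_common_left_multiple_of_rightInv hcomp hM) hP hPexc
    refine eventually_le_pow_of_polynomial_bound
      (growth_le_of_natDegree_fibers (K := K) fun m => ?_) hc
    obtain ⟨T, hTK, hT⟩ := hK m
    exact ⟨T, hTK, fun n Q hQ => hT Q (hwords n hQ)⟩
  · intro hsub
    have hfin : ∀ n, {s : S | (s : ℂ[X]) ∈ wordsUpTo F n}.Finite := fun n =>
      (wordsUpTo_finite F n).preimage Subtype.val_injective.injOn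
    let A : ℕ → Finset S := fun n => (hfin (n + 1)).toFinset
    have hmem : ∀ n s, s ∈ A n ↔ (s : ℂ[X]) ∈ wordsUpTo F (n + 1) := fun n s => by simp [A]
    have hcard : ∀ n, (A n).card = growth F (n + 1) := fun n => by
      rw [growth, ← Set.ncard_coe_finset, ← Set.ncard_image_of_injective _ Subtype.val_injective]
      congr 1
      ext p
      constructor
      · rintro ⟨s, hs, rfl⟩
        exact (hmem n s).1 hs
      · exact fun hp => ⟨⟨p, hwords _ hp⟩, (hmem n _).2 hp, rfl⟩
    obtain ⟨q, hq⟩ : ∃ q, q ∈ F := by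
      rw [hgen] at hP
      obtain ⟨l, hl, hF, -⟩ := hP
      exact ⟨l.head hl, hF _ (List.head_mem hl)⟩
    have hne : ∀ n, (A n).Nonempty := fun n =>
      ⟨⟨q, hFS q hq⟩, (hmem n _).2 ⟨[q], by simp, by simp, by simpa using hq, by simp⟩⟩
    obtain ⟨M, hM⟩ := exists_mean_of_slow_growth A
      (fun n s hs => (hmem _ s).2 <| by
        obtain ⟨l, h₁, h₂, h₃⟩ := (hmem _ s).1 hs
        exact ⟨l, h₁, h₂.trans (Nat.le_succ _), h₃⟩)
      hne fun ε hε => exists_succ_le_of_subexponential (a := fun n => (A n).card)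
        (hne 0).card_pos (fun c hc => by
          obtain ⟨N, hN⟩ := hsub c hc
          exact ⟨N, fun n hn => by rw [hcard]; exact hN (n + 1) (by omega)⟩) hε
    refine ⟨M, polyRightInv_of_generators hgen fun q hq hc f hf => ?_⟩
    refine hM (fun g => ⟨(g : ℂ[X]).comp q, hc g⟩) (fun g₁ g₂ h => ?_)
      (fun n a ha => (hmem _ _).2 (comp_mem_wordsUpTo_succ ((hmem _ _).1 ha) hq)) f hf
    exact Subtype.ext (comp_right_cancel (hdeg q (hFS q hq)) (congrArg Subtype.val h))
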